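/- (Characterization of the Lorentzian tuboids.) Fix r > 0. Then T₊ = { z ∈ dS_{ℂ,r} : η(Im z, p) < 0 for every p ∈ ℝ³ with Q(p) = 0 and p₀ > 0 }, and T₋ = { z ∈ dS_{ℂ,r} : η(Im z, p) > 0 for every p ∈ ℝ³ with Q(p) = 0 and p₀ > 0 }. -/

import Mathlib

open Matrix

noncomputable section

/-- The Minkowski bilinear form `η(x,y) = x₀y₀ − x₁y₁ − x₂y₂` on ℝ³. -/
def mink (x y : Fin 3 → ℝ) : ℝ := x 0 * y 0 - x 1 * y 1 - x 2 * y 2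

/-- The Minkowski quadratic form `Q(x) = η(x,x)`. -/
def Qf (x : Fin 3 → ℝ) : ℝ := mink x x

/-- The Minkowski metric matrix `diag(1,−1,−1)`. -/
def etaM : Matrix (Fin 3) (Fin 3) ℝ := !![1, 0, 0; 0, -1, 0; 0, 0, -1]

/-- The Lorentz group `O(1,2)`, as a set of 3×3 real matrices. -/
def O12 : Set (Matrix (Fin 3) (Fin 3) ℝ) := {L | L * etaM * Lᵀ = etaM}

/-- The proper orthochronous Lorentz group `SO₀(1,2)`. -/
def SO012 : Set (Matrix (Fin 3) (Fin 3) ℝ) :=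
  {L | L * etaM * Lᵀ = etaM ∧ L.det = 1 ∧ 0 < L 0 0}

/-- The rotation `R₀(α)` around the `x₀`-axis. -/
def R0 (α : ℝ) : Matrix (Fin 3) (Fin 3) ℝ :=
  !![1, 0, 0; 0, Real.cos α, -Real.sin α; 0, Real.sin α, Real.cos α]

/-- The boost `Λ₁(t)` leaving the `x₁`-axis invariant. -/
def B1 (t : ℝ) : Matrix (Fin 3) (Fin 3) ℝ :=
  !![Real.cosh t, 0, Real.sinh t; 0, 1, 0; Real.sinh t, 0, Real.cosh t]

/-- The boost `Λ₂(s)` leaving the `x₂`-axis invariant. -/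
def B2 (s : ℝ) : Matrix (Fin 3) (Fin 3) ℝ :=
  !![Real.cosh s, Real.sinh s, 0; Real.sinh s, Real.cosh s, 0; 0, 0, 1]

/-- The horospherical translation `D(q)`. -/
def Dm (q : ℝ) : Matrix (Fin 3) (Fin 3) ℝ :=
  !![1 + q ^ 2 / 2, q, q ^ 2 / 2; q, 1, q; -(q ^ 2 / 2), -q, 1 - q ^ 2 / 2]

/-- The time reflection `T = diag(−1,1,1)`. -/
def Tm : Matrix (Fin 3) (Fin 3) ℝ := !![-1, 0, 0; 0, 1, 0; 0, 0, 1]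

/-- The space reflection `P = diag(1,−1,−1)`. -/
def Pm : Matrix (Fin 3) (Fin 3) ℝ := !![1, 0, 0; 0, -1, 0; 0, 0, -1]

/-- The complex de Sitter space `dS_{ℂ,r}`. -/
def dSC (r : ℝ) : Set (Fin 3 → ℂ) :=
  {z | z 0 ^ 2 - z 1 ^ 2 - z 2 ^ 2 = -(r : ℂ) ^ 2}

/-- The componentwise imaginary part of a complex vector. -/
def imVec (z : Fin 3 → ℂ) : Fin 3 → ℝ := fun i => (z i).im

/-- The forward tuboid `T₊`. -/
def Tplus (r : ℝ) : Set (Fin 3 → ℂ) :=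
  {z | ∃ L ∈ SO012, ∃ θ ∈ Set.Ioo (-Real.pi) (0 : ℝ),
    z = (L.map Complex.ofReal).mulVec
      ![Complex.I * ((r * Real.sin θ : ℝ) : ℂ), 0, ((r * Real.cos θ : ℝ) : ℂ)]}

/-- The backward tuboid `T₋`. -/
def Tminus (r : ℝ) : Set (Fin 3 → ℂ) :=
  {z | ∃ L ∈ SO012, ∃ θ ∈ Set.Ioo (0 : ℝ) Real.pi,
    z = (L.map Complex.ofReal).mulVec
      ![Complex.I * ((r * Real.sin θ : ℝ) : ℂ), 0, ((r * Real.cos θ : ℝ) : ℂ)]}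


lemma cols_of_mem {L : Matrix (Fin 3) (Fin 3) ℝ} (h : L * etaM * Lᵀ = etaM) :
    Lᵀ * etaM * L = etaM := by
  have hee : etaM * etaM = 1 := by
    ext i j; fin_cases i <;> fin_cases j <;> simp [etaM, Matrix.mul_apply, Fin.sum_univ_three]
  have h1 : L * (etaM * Lᵀ * etaM) = 1 := by
    rw [← hee]; nth_rewrite 3 [← h]; simp only [Matrix.mul_assoc]
  have h2 := mul_eq_one_comm.mp h1
  calc Lᵀ * etaM * L = (etaM * etaM) * (Lᵀ * etaM * L) := by rw [hee, Matrix.one_mul]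
    _ = etaM * (etaM * Lᵀ * etaM * L) := by simp only [Matrix.mul_assoc]
    _ = etaM := by rw [h2, Matrix.mul_one]

lemma mem_of_cols {L : Matrix (Fin 3) (Fin 3) ℝ} (h : Lᵀ * etaM * L = etaM) :
    L * etaM * Lᵀ = etaM := by
  have := cols_of_mem (L := Lᵀ) (by simpa using h)
  simpa using this

/-- Future timelike and future lightlike vectors have positive product. -/
lemma timelike_pos (a0 a1 a2 p0 p1 p2 : ℝ) (ha : 0 < a0) (hQ : a0 * a0 - a1 * a1 - a2 * a2 = 1)
    (hp : p0 * p0 - p1 * p1 - p2 * p2 = 0) (hp0 : 0 < p0) :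
    0 < a0 * p0 - a1 * p1 - a2 * p2 := by
  have h : (a1 * p1 + a2 * p2) ^ 2 < (a0 * p0) ^ 2 := by
    nlinarith [sq_nonneg (a1 * p2 - a2 * p1), mul_pos hp0 hp0]
  have := abs_lt_of_sq_lt_sq h (by positivity)
  linarith [(abs_lt.mp this).2]

lemma forward_dir (r : ℝ) (θ : ℝ) (L : Matrix (Fin 3) (Fin 3) ℝ)
    (hL : L ∈ SO012) (z : Fin 3 → ℂ) (hz : z = (L.map Complex.ofReal).mulVec
      ![Complex.I * ((r * Real.sin θ : ℝ) : ℂ), 0, ((r * Real.cos θ : ℝ) : ℂ)]) :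
    z ∈ dSC r ∧ ∀ p : Fin 3 → ℝ, Qf p = 0 → 0 < p 0 →
      ∃ m : ℝ, 0 < m ∧ mink (imVec z) p = r * Real.sin θ * m := by
  obtain ⟨h, -, h0⟩ := hL
  have h' := cols_of_mem h
  have e00 := congrFun (congrFun h' 0) 0
  have e02 := congrFun (congrFun h' 0) 2
  have e22 := congrFun (congrFun h' 2) 2
  simp [etaM, Matrix.mul_apply, Fin.sum_univ_three] at e00 e02 e22
  have z0 : ∀ i, z i = ((L i 2 * (r * Real.cos θ) : ℝ) : ℂ)
      + Complex.I * ((L i 0 * (r * Real.sin θ) : ℝ) : ℂ) := by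
    intro i
    subst hz
    simp [Matrix.mulVec, dotProduct, Fin.sum_univ_three]
    ring
  have sc := Real.sin_sq_add_cos_sq θ
  clear hz
  generalize Real.sin θ = S at *
  generalize Real.cos θ = C at *
  constructor
  · change z 0 ^ 2 - z 1 ^ 2 - z 2 ^ 2 = -(r : ℂ) ^ 2
    rw [z0, z0, z0]
    apply Complex.ext
    · simp [pow_two]
      linear_combination (r * C)^2 * e22 - (r * S)^2 * e00 - r^2 * sc
    · simp [pow_two]
      linear_combination 2 * (r * C) * (r * S) * e02
  · intro p hp hp0
    simp only [Qf, mink] at hp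
    refine ⟨_, timelike_pos (L 0 0) (L 1 0) (L 2 0) _ _ _ h0 (by linarith) hp hp0, ?_⟩
    have hi : ∀ i, imVec z i = L i 0 * (r * S) := by
      intro i; rw [imVec, z0]; simp
    simp only [mink, hi]
    ring

lemma frame (a0 a1 a2 c0 c1 c2 : ℝ) (ha : 0 < a0) (haa : a0 * a0 - a1 * a1 - a2 * a2 = 1)
    (hcc : c0 * c0 - c1 * c1 - c2 * c2 = -1) (hac : a0 * c0 - a1 * c1 - a2 * c2 = 0) :
    (!![a0, a1 * c2 - a2 * c1, c0; a1, a0 * c2 - a2 * c0, c1; a2, a1 * c0 - a0 * c1, c2] :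
      Matrix (Fin 3) (Fin 3) ℝ) ∈ SO012 := by
  have key : (a1 * c2 - a2 * c1) * (a1 * c2 - a2 * c1) - (a0 * c2 - a2 * c0) * (a0 * c2 - a2 * c0)
      - (a1 * c0 - a0 * c1) * (a1 * c0 - a0 * c1) = -1 := by
    linear_combination (c0 * c0 - c1 * c1 - c2 * c2) * haa + hcc
      - (a0 * c0 - a1 * c1 - a2 * c2) * hac
  refine ⟨mem_of_cols ?_, ?_, ?_⟩
  · ext i j
    fin_cases i <;> fin_cases j <;>
      simp [etaM, Matrix.mul_apply, Fin.sum_univ_three] <;>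
      first
        | linear_combination haa
        | linear_combination hcc
        | linear_combination hac
        | linear_combination key
        | ring
  · simp [Matrix.det_fin_three]
    linear_combination -key
  · simpa using ha

lemma norm_div_eq (a b c k q : ℝ) (hk : 0 < k) (h : a * a - b * b - c * c = q * (k * k)) :
    (a / k) * (a / k) - (b / k) * (b / k) - (c / k) * (c / k) = q := by
  have : (a / k) * (a / k) - (b / k) * (b / k) - (c / k) * (c / k)
      = (a * a - b * b - c * c) / (k * k) := by ring
  rw [this, h]
  field_simp

set_option maxHeartbeats 1000000 in
lemma backward_dir (r : ℝ) (hr : 0 < r) (z : Fin 3 → ℂ) (hz : z ∈ dSC r)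
    (hp : ∀ p : Fin 3 → ℝ, Qf p = 0 → 0 < p 0 → 0 < mink (imVec z) p) : z ∈ Tminus r := by
  change z 0 ^ 2 - z 1 ^ 2 - z 2 ^ 2 = -(r : ℂ) ^ 2 at hz
  obtain ⟨x0, hx0⟩ : ∃ x, (z 0).re = x := ⟨_, rfl⟩
  obtain ⟨x1, hx1⟩ : ∃ x, (z 1).re = x := ⟨_, rfl⟩
  obtain ⟨x2, hx2⟩ : ∃ x, (z 2).re = x := ⟨_, rfl⟩
  obtain ⟨y0, hy0⟩ : ∃ x, (z 0).im = x := ⟨_, rfl⟩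
  obtain ⟨y1, hy1⟩ : ∃ x, (z 1).im = x := ⟨_, rfl⟩
  obtain ⟨y2, hy2⟩ : ∃ x, (z 2).im = x := ⟨_, rfl⟩
  have hre := congrArg Complex.re hz
  have him := congrArg Complex.im hz
  simp [pow_two, hx0, hx1, hx2, hy0, hy1, hy2] at hre him
  simp only [Qf, mink, imVec, hy0, hy1, hy2] at hp
  have hxy : x0 * y0 - x1 * y1 - x2 * y2 = 0 := by linarith
  -- the imaginary part is future timelike
  have hy : 0 < y0 ∧ 0 < y0 * y0 - y1 * y1 - y2 * y2 := by
    have hn := Real.sqrt_nonneg (y1 * y1 + y2 * y2)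
    have hs := Real.mul_self_sqrt (show 0 ≤ y1 * y1 + y2 * y2 by nlinarith [sq_nonneg y1, sq_nonneg y2])
    set n := Real.sqrt (y1 * y1 + y2 * y2)
    rcases hn.eq_or_lt with h0 | h0
    · have := hp ![1, 1, 0] (by simp) (by simp)
      rw [← h0] at hs
      have e1 : y1 = 0 := by nlinarith [sq_nonneg y1, sq_nonneg y2]
      have e2 : y2 = 0 := by nlinarith [sq_nonneg y1, sq_nonneg y2]
      subst e1 e2
      simp at this
      exact ⟨this, by nlinarith⟩
    · have := hp ![n, y1, y2] (by simp; linarith) (by simpa using h0)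
      simp at this
      have h1 : n < y0 := by
        by_contra hc
        nlinarith
      exact ⟨by linarith, by nlinarith⟩
  obtain ⟨hy0p, hQy⟩ := hy
  have hQx : (x0 = 0 ∧ x1 = 0 ∧ x2 = 0) ∨ 0 < x1 * x1 + x2 * x2 - x0 * x0 := by
    by_cases h : x1 = 0 ∧ x2 = 0
    · left
      obtain ⟨e1, e2⟩ := h
      subst e1 e2
      simp at hxy
      rcases hxy with h | h
      · exact ⟨h, rfl, rfl⟩
      · linarith
    · right
      have hpos : 0 < x1 * x1 + x2 * x2 := by
        by_contra hc
        exact h ⟨by nlinarith [sq_nonneg x1, sq_nonneg x2], by nlinarith [sq_nonneg x1, sq_nonneg x2]⟩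
      have e : (x1 * x1 + x2 * x2 - x0 * x0) * (y0 * y0)
          = (x1 * x1 + x2 * x2) * (y0 * y0 - y1 * y1 - y2 * y2) + (x1 * y2 - x2 * y1) ^ 2 := by
        linear_combination -(x0 * y0 + x1 * y1 + x2 * y2) * hxy
      have : 0 < (x1 * x1 + x2 * x2 - x0 * x0) * (y0 * y0) := by
        rw [e]; positivity
      exact (mul_pos_iff_of_pos_right (by positivity)).mp this
  -- write `y = s a`, `x = k c`
  obtain ⟨s, hs, hss⟩ : ∃ s : ℝ, 0 < s ∧ s * s = y0 * y0 - y1 * y1 - y2 * y2 :=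
    ⟨_, Real.sqrt_pos.mpr hQy, Real.mul_self_sqrt hQy.le⟩
  obtain ⟨k, c0, c1, c2, hk, e0, e1, e2, hcc, hyc⟩ : ∃ k c0 c1 c2 : ℝ, 0 ≤ k ∧ x0 = c0 * k ∧
      x1 = c1 * k ∧ x2 = c2 * k ∧ c0 * c0 - c1 * c1 - c2 * c2 = -1 ∧
      y0 * c0 - y1 * c1 - y2 * c2 = 0 := by
    rcases hQx with ⟨h0, h1, h2⟩ | hQ
    · have hm : 0 < y0 * y0 - y1 * y1 := by nlinarith [mul_self_nonneg y2]
      obtain ⟨m, hm0, hmm⟩ : ∃ m : ℝ, 0 < m ∧ m * m = y0 * y0 - y1 * y1 :=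
        ⟨_, Real.sqrt_pos.mpr hm, Real.mul_self_sqrt hm.le⟩
      refine ⟨0, y1 / m, y0 / m, 0, le_rfl, by simp [h0], by simp [h1], by simp [h2], ?_, ?_⟩
      · have := norm_div_eq y1 y0 0 m (-1) hm0 (by linarith)
        simpa using this
      · ring
    · obtain ⟨k, hk0, hkk⟩ : ∃ k : ℝ, 0 < k ∧ k * k = x1 * x1 + x2 * x2 - x0 * x0 :=
        ⟨_, Real.sqrt_pos.mpr hQ, Real.mul_self_sqrt hQ.le⟩
      refine ⟨k, x0 / k, x1 / k, x2 / k, hk0.le, by field_simp, by field_simp, by field_simp, ?_, ?_⟩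
      · exact norm_div_eq x0 x1 x2 k (-1) hk0 (by linarith)
      · have : y0 * (x0 / k) - y1 * (x1 / k) - y2 * (x2 / k)
            = (x0 * y0 - x1 * y1 - x2 * y2) / k := by ring
        rw [this, hxy, zero_div]
  have hsk : s * s + k * k = r * r := by
    subst e0 e1 e2
    linear_combination hss - hre + k * k * hcc
  have hrr : (s / r) ^ 2 + (k / r) ^ 2 = 1 := by
    have : (s / r) ^ 2 + (k / r) ^ 2 = (s * s + k * k) / (r * r) := by ring
    rw [this, hsk]
    field_simp
  have hsr : 0 < s / r := by positivity
  have hkr : 0 ≤ k / r := by positivity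
  have hsr1 : s / r ≤ 1 := (sq_le_one_iff₀ hsr.le).mp (by linarith [sq_nonneg (k / r)])
  refine ⟨_, frame (y0 / s) (y1 / s) (y2 / s) c0 c1 c2 (by positivity)
    (norm_div_eq y0 y1 y2 s 1 hs (by linarith)) hcc (by
      have : y0 / s * c0 - y1 / s * c1 - y2 / s * c2 = (y0 * c0 - y1 * c1 - y2 * c2) / s := by ring
      rw [this, hyc, zero_div]), Real.arcsin (s / r),
    ⟨Real.arcsin_pos.mpr hsr, ?_⟩, ?_⟩
  · linarith [Real.arcsin_le_pi_div_two (s / r), Real.pi_pos]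
  · have hsin : r * Real.sin (Real.arcsin (s / r)) = s := by
      rw [Real.sin_arcsin (by linarith) hsr1]; field_simp
    have hcos : r * Real.cos (Real.arcsin (s / r)) = k := by
      rw [Real.cos_arcsin, show 1 - (s / r) ^ 2 = (k / r) ^ 2 by linarith, Real.sqrt_sq hkr]
      field_simp
    rw [hsin, hcos]
    have hs' := hs.ne'
    ext i
    fin_cases i <;> apply Complex.ext <;>
      simp [Matrix.mulVec, dotProduct, Fin.sum_univ_three, hx0, hx1, hx2, hy0, hy1, hy2,
        e0, e1, e2, Matrix.vecHead, Matrix.vecTail, hs']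

/-- characterization of the Lorentzian tuboids: `T₊` (resp. `T₋`) consists
of those `z ∈ dS_{ℂ,r}` with `η(Im z, p) < 0` (resp. `> 0`) for every future-pointing
lightlike `p`. -/
theorem tuboid_characterization (r : ℝ) (hr : 0 < r) :
    (Tplus r = {z ∈ dSC r | ∀ p : Fin 3 → ℝ, Qf p = 0 → 0 < p 0 → mink (imVec z) p < 0}) ∧
    (Tminus r = {z ∈ dSC r | ∀ p : Fin 3 → ℝ, Qf p = 0 → 0 < p 0 → 0 < mink (imVec z) p}) := by
  constructor
  · ext z
    constructor
    · rintro ⟨L, hL, θ, ⟨h1, h2⟩, hz⟩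
      obtain ⟨ha, hb⟩ := forward_dir r θ L hL z hz
      refine ⟨ha, fun p hp hp0 => ?_⟩
      obtain ⟨m, hm, e⟩ := hb p hp hp0
      rw [e]
      have := Real.sin_neg_of_neg_of_neg_pi_lt h2 h1
      exact mul_neg_of_neg_of_pos (mul_neg_of_pos_of_neg hr this) hm
    · rintro ⟨hz, hp⟩
      have hc : (fun i => (starRingEnd ℂ) (z i)) ∈ Tminus r := by
        apply backward_dir r hr
        · have := congrArg (starRingEnd ℂ) (show z 0 ^ 2 - z 1 ^ 2 - z 2 ^ 2 = -(r : ℂ) ^ 2 from hz)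
          simpa [dSC] using this
        · intro p h1 h2
          have := hp p h1 h2
          simp only [mink, imVec, Complex.conj_im] at this ⊢
          linarith
      obtain ⟨L, hL, θ, ⟨h1, h2⟩, hz'⟩ := hc
      refine ⟨L, hL, -θ, ⟨by linarith, by linarith⟩, ?_⟩
      ext i
      have := congrArg (starRingEnd ℂ) (congrFun hz' i)
      rw [Complex.conj_conj] at this
      rw [this, Real.sin_neg, Real.cos_neg]
      generalize Real.sin θ = S
      generalize Real.cos θ = C
      simp [Matrix.mulVec, dotProduct, Fin.sum_univ_three]
  · ext z
    constructor
    · rintro ⟨L, hL, θ, ⟨h1, h2⟩, hz⟩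
      obtain ⟨ha, hb⟩ := forward_dir r θ L hL z hz
      refine ⟨ha, fun p hp hp0 => ?_⟩
      obtain ⟨m, hm, e⟩ := hb p hp hp0
      rw [e]
      have := Real.sin_pos_of_pos_of_lt_pi h1 h2
      positivity
    · rintro ⟨hz, hp⟩
      exact backward_dir r hr z hz hp
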